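/- Let R be a commutative ring, I an ideal of R, M an R-module, and P a proper submodule of M. Then the following are equivalent: (1) P is an I-primary submodule of M; (2) for every r ∈ R with r ∉ √(P : M), one has (P : r) = P ∪ (IP : r) (as sets); (3) for every r ∈ R with r ∉ √(P : M), either (P : r) = P or (P : r) = (IP : r). -/

import Mathlib

/-- `P` is an `I`-primary submodule of `M`. -/
def IsIPrimary {R : Type*} [CommRing R] {M : Type*} [AddCommGroup M] [Module R M]
    (I : Ideal R) (P : Submodule R M) : Prop :=
  P ≠ ⊤ ∧ ∀ r : R, ∀ m : M, r • m ∈ P → r • m ∉ I • P →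
    m ∈ P ∨ r ∈ (P.colon ⊤).radical

/-- For `r : R` and a submodule `N` of `M`, `(N : r)` is the submodule
`{m : M | r • m ∈ N}`, realized as `N.comap (r • LinearMap.id)`. -/
def colonElt {R : Type*} [CommRing R] {M : Type*} [AddCommGroup M] [Module R M]
    (N : Submodule R M) (r : R) : Submodule R M :=
  N.comap (r • (LinearMap.id : M →ₗ[R] M))

theorem stmt2 {R : Type*} [CommRing R] {M : Type*} [AddCommGroup M] [Module R M]
    (I : Ideal R) (P : Submodule R M) (hP : P ≠ ⊤) :
    List.TFAE
      [ IsIPrimary I P,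
        ∀ r : R, r ∉ (P.colon ⊤).radical →
          (colonElt P r : Set M) = (P : Set M) ∪ (colonElt (I • P) r : Set M),
        ∀ r : R, r ∉ (P.colon ⊤).radical →
          colonElt P r = P ∨ colonElt P r = colonElt (I • P) r ] := by
  have mem : ∀ (N : Submodule R M) (r : R) (m : M), m ∈ colonElt N r ↔ r • m ∈ N := by
    intro N r m
    simp [colonElt]
  have hIP : ∀ m, m ∈ I • P → m ∈ P := fun m hm => Submodule.smul_le_right hm
  tfae_have 1 → 2 := by
    rintro ⟨_, h⟩ r hr
    ext m
    simp only [Set.mem_union, SetLike.mem_coe, mem]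
    constructor
    · intro hm
      by_cases hi : r • m ∈ I • P
      · exact Or.inr hi
      · exact Or.inl ((h r m hm hi).resolve_right hr)
    · rintro (hm | hm)
      · exact P.smul_mem r hm
      · exact hIP _ hm
  tfae_have 2 → 3 := by
    intro h r hr
    have h2 : ∀ m, r • m ∈ P → m ∈ P ∨ r • m ∈ I • P := by
      intro m hm
      have h3 : m ∈ (colonElt P r : Set M) := (mem P r m).2 hm
      rw [h r hr] at h3
      exact h3.imp id (mem _ r m).1
    by_cases hx : ∀ m, r • m ∈ P → m ∈ P
    · left
      ext m
      rw [mem]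
      exact ⟨hx m, P.smul_mem r⟩
    · right
      push Not at hx
      obtain ⟨x, hx, hxP⟩ := hx
      have hxI := (h2 x hx).resolve_left hxP
      ext y
      rw [mem, mem]
      refine ⟨fun hy => ?_, hIP _⟩
      rcases h2 y hy with hyP | hyI
      · have hxy : r • (x + y) ∈ P := by
          rw [smul_add]
          exact P.add_mem hx hy
        rcases h2 _ hxy with h4 | h4
        · exact absurd ((P.add_mem_iff_left hyP).1 h4) hxP
        · rw [smul_add] at h4
          exact ((I • P).add_mem_iff_right hxI).1 h4
      · exact hyI
  tfae_have 3 → 1 := by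
    intro h
    refine ⟨hP, fun r m hm hi => ?_⟩
    by_cases hr : r ∈ (P.colon ⊤).radical
    · exact Or.inr hr
    · left
      have hm' := (mem P r m).2 hm
      rcases h r hr with h1 | h1
      · rwa [h1] at hm'
      · rw [h1, mem] at hm'
        exact absurd hm' hi
  tfae_finish
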